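/- arXiv:1402.2634 — 2 statements merged into one kernel-verified Lean document; each statement's English description precedes it below -/
import Mathlib

section
/- Consider n agents with Lagrangian dynamics M_i(q_i)q̈_i + C_i(q_i, q̇_i)q̇_i = τ_i, q_i(t) ∈ ℝ^m, under the control law τ_i = −k q̇_i − (q_i − P_{X_i}(q_i)) − Σ_{j∈N_i} a_{ij}(q_i − q_j), with damping gain k > 0, over a fixed undirected communication graph G. If X_1, …, X_n are closed convex sets whose intersection X₀ = ∩_{i=1}^n X_i is nonempty and bounded, and G is connected, then every solution of the closed-loop system satisfies: (1) lim_{t→∞} ‖q_i(t)‖_{X₀} = 0 for all i; (2) lim_{t→∞} (q_i(t) − q_j(t)) = 0 for all i, j; (3) lim_{t→∞} q̇_i(t) = 0 for all i. -/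
open scoped RealInnerProductSpace Topology BigOperators

lemma barb {E : Type*} [NormedAddCommGroup E] [NormedSpace ℝ E] (f e g : ℝ → E) (c : E)
    (hf : Filter.Tendsto f Filter.atTop (𝓝 c))
    (hd : ∀ t, HasDerivAt f (e t - g t) t)
    (he : Filter.Tendsto e Filter.atTop (𝓝 0)) (L : ℝ) (hL : 0 ≤ L)
    (hg : ∀ s t, 0 ≤ s → s ≤ t → ‖g t - g s‖ ≤ L * (t - s)) :
    Filter.Tendsto g Filter.atTop (𝓝 0) := by
  rw [Metric.tendsto_atTop] at hf he ⊢
  intro ε hε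
  set h : ℝ := ε / (4 * (L + 1)) with hh
  have hpos : 0 < h := by positivity
  have hLh : L * h ≤ ε / 4 := by
    rw [hh, mul_div_assoc', div_le_div_iff₀ (by positivity) (by positivity)]
    nlinarith
  obtain ⟨T1, hT1⟩ := hf (h * ε / 8) (by positivity)
  obtain ⟨T2, hT2⟩ := he (ε / 4) (by positivity)
  refine ⟨max 0 (max T1 T2), fun t ht => ?_⟩
  simp only [ge_iff_le, max_le_iff] at ht
  obtain ⟨h0, h1, h2⟩ := ht
  have key := norm_image_sub_le_of_norm_deriv_le_segment' (f := fun s => f s + (s - t) • g t)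
    (f' := fun s => e s - g s + (1 : ℝ) • g t) (a := t) (b := t + h) (C := ε / 4 + L * h)
    (fun s _ => ((hd s).add (((hasDerivAt_id s).sub_const t).smul_const (g t))).hasDerivWithinAt)
    (by
      intro s hs
      have a1 := hT2 s (by linarith [hs.1])
      have a2 := hg t s h0 hs.1
      have a3 : L * (s - t) ≤ L * h := mul_le_mul_of_nonneg_left (by linarith [hs.2]) hL
      rw [dist_zero_right] at a1
      have : e s - g s + (1 : ℝ) • g t = e s - (g s - g t) := by rw [one_smul]; abel
      rw [this]
      exact (norm_sub_le _ _).trans (by linarith)) (t + h) ⟨by linarith, le_refl _⟩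
  have b1 := hT1 t h1
  have b2 := hT1 (t + h) (by linarith)
  rw [dist_eq_norm] at b1 b2
  rw [dist_zero_right]
  simp only [add_sub_cancel_left, sub_self, zero_smul, add_zero] at key
  have e1 : h • g t = (f (t + h) + h • g t - f t) - (f (t + h) - c) + (f t - c) := by abel
  have e2 : ‖h • g t‖ ≤ ‖f (t + h) + h • g t - f t‖ + ‖f (t + h) - c‖ + ‖f t - c‖ := by
    conv_lhs => rw [e1]
    exact (norm_add_le _ _).trans (add_le_add_left (norm_sub_le _ _) _)
  rw [norm_smul, Real.norm_of_nonneg hpos.le] at e2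
  have : h * ‖g t‖ < h * ε := by nlinarith
  exact lt_of_mul_lt_mul_left this hpos.le

lemma proj_inner {E : Type*} [NormedAddCommGroup E] [InnerProductSpace ℝ E] {X : Set E}
    (hX : Convex ℝ X) {P : E → E} (hm : ∀ x, P x ∈ X)
    (hp : ∀ x, ∀ y ∈ X, ‖x - P x‖ ≤ ‖x - y‖) (x y : E) (hy : y ∈ X) :
    ⟪x - P x, y - P x⟫ ≤ 0 := by
  refine (norm_eq_iInf_iff_real_inner_le_zero hX (hm x)).1 ?_ y hy
  haveI : Nonempty X := ⟨⟨P x, hm x⟩⟩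
  refine le_antisymm (le_ciInf fun w => hp x w w.2) ?_
  exact ciInf_le ⟨0, by rintro _ ⟨w, rfl⟩; exact norm_nonneg _⟩ (⟨P x, hm x⟩ : X)

lemma proj_lip {E : Type*} [NormedAddCommGroup E] [InnerProductSpace ℝ E] {X : Set E}
    (hX : Convex ℝ X) {P : E → E} (hm : ∀ x, P x ∈ X)
    (hp : ∀ x, ∀ y ∈ X, ‖x - P x‖ ≤ ‖x - y‖) (x y : E) :
    ‖P x - P y‖ ≤ ‖x - y‖ := by
  have h1 := proj_inner hX hm hp x (P y) (hm y)
  have h2 := proj_inner hX hm hp y (P x) (hm x)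
  have h3 : ⟪x - y, P x - P y⟫ - ⟪P x - P y, P x - P y⟫ =
      -⟪x - P x, P y - P x⟫ - ⟪y - P y, P x - P y⟫ := by
    simp only [inner_sub_left, inner_sub_right]; ring
  have h4 := real_inner_le_norm (x - y) (P x - P y)
  rw [real_inner_self_eq_norm_sq] at h3
  by_contra hc
  push Not at hc
  nlinarith [norm_nonneg (x - y)]

lemma res_lip {E : Type*} [NormedAddCommGroup E] [InnerProductSpace ℝ E] {X : Set E}
    (hX : Convex ℝ X) {P : E → E} (hm : ∀ x, P x ∈ X)
    (hp : ∀ x, ∀ y ∈ X, ‖x - P x‖ ≤ ‖x - y‖) (x y : E) :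
    ‖(x - P x) - (y - P y)‖ ≤ 2 * ‖x - y‖ := by
  have : (x - P x) - (y - P y) = (x - y) - (P x - P y) := by abel
  rw [this]
  linarith [norm_sub_le (x - y) (P x - P y), proj_lip hX hm hp x y]

lemma proj_fderiv {E : Type*} [NormedAddCommGroup E] [InnerProductSpace ℝ E] {X : Set E}
    (hX : Convex ℝ X) {P : E → E} (hm : ∀ x, P x ∈ X)
    (hp : ∀ x, ∀ y ∈ X, ‖x - P x‖ ≤ ‖x - y‖) (x : E) :
    HasFDerivAt (fun x => ‖x - P x‖ ^ 2 / 2) (innerSL ℝ (x - P x)) x := by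
  have up : ∀ x y, ‖y - P y‖ ^ 2 / 2 ≤ ‖x - P x‖ ^ 2 / 2 + ⟪x - P x, y - x⟫ + ‖y - x‖ ^ 2 / 2 := by
    intro x y
    have h1 := hp y (P x) (hm x)
    have h2 : ‖y - P y‖ ^ 2 ≤ ‖y - P x‖ ^ 2 := by gcongr
    have h3 : y - P x = (x - P x) + (y - x) := by abel
    rw [h3, norm_add_sq_real] at h2
    linarith
  rw [hasFDerivAt_iff_isLittleO]
  have : (fun y => ‖y - P y‖ ^ 2 / 2 - ‖x - P x‖ ^ 2 / 2 - (innerSL ℝ (x - P x)) (y - x))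
      =O[𝓝 x] fun y => ‖y - x‖ ^ 2 := by
    refine Asymptotics.IsBigO.of_bound 3 (Filter.Eventually.of_forall fun y => ?_)
    rw [innerSL_apply_apply, Real.norm_eq_abs, Real.norm_of_nonneg (by positivity), abs_le]
    have u1 := up x y
    have u2 := up y x
    have h1 := res_lip hX hm hp y x
    have h2 := real_inner_le_norm ((x - P x) - (y - P y)) (y - x)
    rw [norm_sub_rev] at h1
    have h3 : ‖(x - P x) - (y - P y)‖ * ‖y - x‖ ≤ 2 * ‖y - x‖ * ‖y - x‖ :=
      mul_le_mul_of_nonneg_right h1 (norm_nonneg _)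
    rw [inner_sub_left] at h2
    have h4 : ⟪y - P y, x - y⟫ = - ⟪y - P y, y - x⟫ := by
      rw [← inner_neg_right, neg_sub]
    rw [h4, norm_sub_rev x y] at u2
    constructor <;> nlinarith [sq_nonneg ‖y - x‖]
  refine this.trans_isLittleO ?_
  have := (Asymptotics.isLittleO_norm_pow_id (E' := E) (n := 2) (by norm_num))
  exact (Asymptotics.isLittleO_pow_sub_sub x (by norm_num : 1 < 2))

lemma coercive {E ι : Type*} [NormedAddCommGroup E] [InnerProductSpace ℝ E]
    [FiniteDimensional ℝ E] [Fintype ι] {X : ι → Set E}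
    (hX : ∀ i, Convex ℝ (X i)) {P : ι → E → E} (hm : ∀ i x, P i x ∈ X i)
    (hp : ∀ i x, ∀ y ∈ X i, ‖x - P i x‖ ≤ ‖x - y‖)
    (x0 : E) (hx0 : ∀ i, x0 ∈ X i) (hb : Bornology.IsBounded (⋂ i, X i)) (D : ℝ) :
    ∃ R : ℝ, 0 ≤ R ∧ ∀ x, (∀ i, ‖x - P i x‖ ≤ D) → ‖x - x0‖ ≤ R := by
  obtain ⟨R, hR⟩ := hb.subset_closedBall x0
  have hR0 : 0 ≤ R := by
    have := hR (Set.mem_iInter.2 hx0)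
    simpa using this
  have hPc : ∀ i, Continuous (P i) := fun i =>
    (LipschitzWith.of_dist_le_mul (K := 1) fun x y => by
      rw [dist_eq_norm, dist_eq_norm]; simpa using proj_lip (hX i) (hm i) (hp i) x y).continuous
  have hFc : Continuous fun x => ∑ i, ‖x - P i x‖ := by
    have := hPc
    fun_prop
  obtain ⟨δ, hδ, hδ2⟩ := (isCompact_sphere x0 (R + 1)).exists_forall_le' (a := 0) hFc.continuousOn (by
    intro x hx
    by_contra hc
    have hz : ∑ i, ‖x - P i x‖ = 0 :=
      le_antisymm (not_lt.1 hc) (Finset.sum_nonneg fun i _ => norm_nonneg _)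
    rw [Finset.sum_eq_zero_iff_of_nonneg (fun i _ => norm_nonneg _)] at hz
    have : x ∈ ⋂ i, X i := Set.mem_iInter.2 fun i => by
      have := hz i (Finset.mem_univ i)
      rw [norm_eq_zero, sub_eq_zero] at this
      rw [this]; exact hm i x
    have h1 := hR this
    rw [Metric.mem_closedBall] at h1
    rw [Metric.mem_sphere] at hx
    linarith)
  refine ⟨max (R + 1) ((R + 1) * (Fintype.card ι * D) / δ), le_max_of_le_left (by linarith),
    fun x hx => ?_⟩
  by_cases hxR : ‖x - x0‖ ≤ R + 1
  · exact le_max_of_le_left hxR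
  · apply le_max_of_le_right
    push Not at hxR
    have hxp : 0 < ‖x - x0‖ := by linarith
    set s := (R + 1) / ‖x - x0‖ with hs
    have hs0 : 0 ≤ s := by positivity
    have hs1 : s ≤ 1 := by rw [hs, div_le_one hxp]; exact hxR.le
    have hy := hδ2 (x0 + s • (x - x0)) (by
      rw [Metric.mem_sphere, dist_eq_norm, add_sub_cancel_left, norm_smul, Real.norm_of_nonneg hs0,
        hs]
      field_simp)
    have h2 : ∀ i, ‖x0 + s • (x - x0) - P i (x0 + s • (x - x0))‖ ≤ s * D := by
      intro i
      have hmem : x0 + s • (P i x - x0) ∈ X i :=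
        (hX i).add_smul_sub_mem (hx0 i) (hm i x) ⟨hs0, hs1⟩
      refine (hp i _ _ hmem).trans ?_
      have : x0 + s • (x - x0) - (x0 + s • (P i x - x0)) = s • (x - P i x) := by
        rw [add_sub_add_left_eq_sub, ← smul_sub]; congr 1; abel
      rw [this, norm_smul, Real.norm_of_nonneg hs0]
      exact mul_le_mul_of_nonneg_left (hx i) hs0
    have h3 := hy.trans (Finset.sum_le_sum fun i _ => h2 i)
    simp only [Finset.sum_const, Finset.card_univ, nsmul_eq_mul] at h3
    rw [le_div_iff₀ hδ]
    have h4 : s * ‖x - x0‖ = R + 1 := by rw [hs]; field_simp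
    calc ‖x - x0‖ * δ ≤ ‖x - x0‖ * (Fintype.card ι * (s * D)) := by gcongr
      _ = (s * ‖x - x0‖) * (Fintype.card ι * D) := by ring
      _ = _ := by rw [h4]

lemma infdist_tendsto {E ι : Type*} [NormedAddCommGroup E] [InnerProductSpace ℝ E]
    [FiniteDimensional ℝ E] [Fintype ι] {X : ι → Set E}
    (hX : ∀ i, Convex ℝ (X i)) {P : ι → E → E} (hm : ∀ i x, P i x ∈ X i)
    (hp : ∀ i x, ∀ y ∈ X i, ‖x - P i x‖ ≤ ‖x - y‖)
    (x : ℝ → E) (x0 : E) (R : ℝ) (hR : ∀ t, 0 ≤ t → ‖x t - x0‖ ≤ R)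
    (hx : ∀ i, Filter.Tendsto (fun t => x t - P i (x t)) Filter.atTop (𝓝 0)) :
    Filter.Tendsto (fun t => Metric.infDist (x t) (⋂ j, X j)) Filter.atTop (𝓝 0) := by
  have hPc : ∀ i, Continuous (P i) := fun i =>
    (LipschitzWith.of_dist_le_mul (K := 1) fun x y => by
      rw [dist_eq_norm, dist_eq_norm]; simpa using proj_lip (hX i) (hm i) (hp i) x y).continuous
  have hFc : Continuous fun x => ∑ i, ‖x - P i x‖ := by
    have := hPc
    fun_prop
  have hF : Filter.Tendsto (fun t => ∑ i, ‖x t - P i (x t)‖) Filter.atTop (𝓝 0) := by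
    have := tendsto_finsetSum Finset.univ fun i _ => (hx i).norm
    simpa using this
  rw [Metric.tendsto_atTop]
  intro ε hε
  have hK : IsCompact (Metric.closedBall x0 R ∩ {y | ε ≤ Metric.infDist y (⋂ j, X j)}) :=
    (isCompact_closedBall x0 R).inter_right
      (isClosed_le continuous_const (Metric.continuous_infDist_pt _))
  obtain ⟨δ, hδ, hδ2⟩ := hK.exists_forall_le' (a := 0) hFc.continuousOn (by
    rintro y ⟨-, hy⟩
    by_contra hc
    have hz : ∑ i, ‖y - P i y‖ = 0 :=
      le_antisymm (not_lt.1 hc) (Finset.sum_nonneg fun i _ => norm_nonneg _)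
    rw [Finset.sum_eq_zero_iff_of_nonneg (fun i _ => norm_nonneg _)] at hz
    have : y ∈ ⋂ i, X i := Set.mem_iInter.2 fun i => by
      have := hz i (Finset.mem_univ i)
      rw [norm_eq_zero, sub_eq_zero] at this
      rw [this]; exact hm i y
    have h1 := Metric.infDist_zero_of_mem this
    simp only [Set.mem_setOf_eq] at hy
    linarith)
  obtain ⟨T, hT⟩ := (hF.eventually (gt_mem_nhds hδ)).exists_forall_of_atTop
  refine ⟨max 0 T, fun t ht => ?_⟩
  rw [dist_zero_right, Real.norm_of_nonneg Metric.infDist_nonneg]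
  by_contra hc
  push Not at hc
  have h1 := hδ2 (x t) ⟨by
    rw [Metric.mem_closedBall, dist_eq_norm]; exact hR t (le_trans (le_max_left _ _) ht), hc⟩
  have h2 := hT t (le_trans (le_max_right _ _) ht)
  linarith

lemma pair_sum {E ι : Type*} [NormedAddCommGroup E] [InnerProductSpace ℝ E] [Fintype ι]
    (a : ι → ι → ℝ) (hs : ∀ i j, a i j = a j i) (x w : ι → E) :
    ∑ i, ⟪∑ j, a i j • (x i - x j), w i⟫ = ∑ i, ∑ j, a i j * ⟪x i - x j, w i - w j⟫ / 2 := by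
  have h1 : ∑ i, ⟪∑ j, a i j • (x i - x j), w i⟫ = ∑ i, ∑ j, a i j * ⟪x i - x j, w i⟫ := by
    simp only [sum_inner, real_inner_smul_left]
  have h2 : ∑ i, ∑ j, a i j * ⟪x i - x j, w i⟫ = ∑ i, ∑ j, -(a i j * ⟪x i - x j, w j⟫) := by
    rw [Finset.sum_comm]
    refine Finset.sum_congr rfl fun i _ => Finset.sum_congr rfl fun j _ => ?_
    rw [hs j i, ← neg_sub (x i) (x j), inner_neg_left]; ring
  have h3 : ∑ i, ∑ j, a i j * ⟪x i - x j, w i - w j⟫ / 2 =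
      (∑ i, ∑ j, a i j * ⟪x i - x j, w i⟫ + ∑ i, ∑ j, -(a i j * ⟪x i - x j, w j⟫)) / 2 := by
    simp only [← Finset.sum_add_distrib, Finset.sum_div]
    refine Finset.sum_congr rfl fun i _ => Finset.sum_congr rfl fun j _ => ?_
    rw [inner_sub_right]; ring
  rw [h1, h3, ← h2]; ring

lemma conn_ind {n : ℕ} (a : Fin n → Fin n → ℝ)
    (hconn : (SimpleGraph.fromRel fun i j : Fin n => 0 < a i j).Connected)
    (R : Fin n → Fin n → Prop) (hr : ∀ i, R i i) (hs : ∀ i j, R i j → R j i)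
    (ht : ∀ i j l, R i j → R j l → R i l) (he : ∀ i j, 0 < a i j → R i j) (i j : Fin n) :
    R i j := by
  obtain ⟨w⟩ := hconn.preconnected i j
  induction w with
  | nil => exact hr _
  | cons h _ ih =>
    refine ht _ _ _ ?_ ih
    rw [SimpleGraph.fromRel_adj] at h
    rcases h.2 with h | h
    · exact he _ _ h
    · exact hs _ _ (he _ _ h)

lemma mdot_apply {E : Type*} [NormedAddCommGroup E] [InnerProductSpace ℝ E]
    (M : ℝ → E →L[ℝ] E) (M' C : E →L[ℝ] E) (t : ℝ) (hM : HasDerivAt M M' t)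
    (hsy : ∀ s v w, ⟪M s v, w⟫ = ⟪v, M s w⟫)
    (hsk : ∀ v w, ⟪(M' - (2 : ℝ) • C) v, w⟫ = -⟪(M' - (2 : ℝ) • C) w, v⟫) (v : E) :
    ⟪M' v, v⟫ = 2 * ⟪C v, v⟫ ∧ ‖M' v‖ ≤ 2 * ‖C‖ * ‖v‖ := by
  have hsy' : ∀ v w, ⟪M' v, w⟫ = ⟪v, M' w⟫ := by
    intro v w
    have h1 := (hM.clm_apply (hasDerivAt_const t v)).inner ℝ (hasDerivAt_const t w)
    have h2 := (hasDerivAt_const t v).inner ℝ (hM.clm_apply (hasDerivAt_const t w))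
    have h3 : (fun s => ⟪M s v, w⟫) = fun s => ⟪v, M s w⟫ := funext fun s => hsy s v w
    rw [h3] at h1
    simpa using h1.unique h2
  have h : ∀ w, ⟪M' v, w⟫ = ⟪C v, w⟫ + ⟪C w, v⟫ := by
    intro w
    have h1 := hsk v w
    have h2 := hsy' w v
    rw [real_inner_comm] at h2
    simp only [ContinuousLinearMap.sub_apply, ContinuousLinearMap.smul_apply, inner_sub_left,
      real_inner_smul_left] at h1
    have h3 := hsy' v w
    rw [real_inner_comm (M' w) v] at h3
    linarith
  refine ⟨by rw [h]; ring, ?_⟩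
  have h1 := h (M' v)
  rw [real_inner_self_eq_norm_sq] at h1
  have h2 := real_inner_le_norm (C v) (M' v)
  have h3 := real_inner_le_norm (C (M' v)) v
  have h4 := C.le_opNorm v
  have h5 := C.le_opNorm (M' v)
  have h6 : ‖C v‖ * ‖M' v‖ ≤ ‖C‖ * ‖v‖ * ‖M' v‖ := by gcongr
  have h7 : ‖C (M' v)‖ * ‖v‖ ≤ ‖C‖ * ‖M' v‖ * ‖v‖ := by gcongr
  by_contra hc
  push Not at hc
  have h8 : 0 ≤ 2 * ‖C‖ * ‖v‖ := by positivity
  nlinarith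

set_option maxHeartbeats 1000000 in
/-- Cooperative set aggregation of `n` Lagrangian agents under the
control law `τᵢ = -k q̇ᵢ - (qᵢ - P_{Xᵢ}(qᵢ)) - ∑_{j} a i j (qᵢ - qⱼ)` over a fixed
connected undirected communication graph. -/
theorem statement0
    (m n : ℕ) (hn : 0 < n)
    -- the local target sets
    (X : Fin n → Set (EuclideanSpace ℝ (Fin m)))
    (hXclosed : ∀ i, IsClosed (X i))
    (hXconvex : ∀ i, Convex ℝ (X i))
    (hX0ne : (⋂ i, X i).Nonempty)
    (hX0bdd : Bornology.IsBounded (⋂ i, X i))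
    -- the Euclidean projections onto the local target sets
    (P : Fin n → EuclideanSpace ℝ (Fin m) → EuclideanSpace ℝ (Fin m))
    (hPmem : ∀ i x, P i x ∈ X i)
    (hPproj : ∀ i x, ∀ y ∈ X i, ‖x - P i x‖ ≤ ‖x - y‖)
    -- the symmetric nonnegative communication weights
    (a : Fin n → Fin n → ℝ)
    (ha_symm : ∀ i j, a i j = a j i)
    (ha_nonneg : ∀ i j, 0 ≤ a i j)
    (ha_diag : ∀ i, a i i = 0)
    -- the communication graph (edge iff `a i j > 0`) is connected
    (hconn : (SimpleGraph.fromRel fun i j : Fin n => 0 < a i j).Connected)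
    -- damping gain
    (k : ℝ) (hk : 0 < k)
    -- the inertia operators and Coriolis/centrifugal operators
    (M : Fin n → EuclideanSpace ℝ (Fin m) →
      EuclideanSpace ℝ (Fin m) →L[ℝ] EuclideanSpace ℝ (Fin m))
    (Cc : Fin n → EuclideanSpace ℝ (Fin m) → EuclideanSpace ℝ (Fin m) →
      EuclideanSpace ℝ (Fin m) →L[ℝ] EuclideanSpace ℝ (Fin m))
    (hMsymm : ∀ i x v w, ⟪M i x v, w⟫ = ⟪v, M i x w⟫)
    (μ₁ μ₂ : ℝ) (hμ₁ : 0 < μ₁) (hμ₁₂ : μ₁ ≤ μ₂)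
    (hMlower : ∀ i x v, μ₁ * ‖v‖ ^ 2 ≤ ⟪M i x v, v⟫)
    (hMupper : ∀ i x v, ⟪M i x v, v⟫ ≤ μ₂ * ‖v‖ ^ 2)
    (kC : ℝ) (hkC : 0 < kC)
    (hCbound : ∀ i x v, ‖Cc i x v‖ ≤ kC * ‖v‖)
    (hMcont : ∀ i, Continuous (M i))
    (hCcont : ∀ i, Continuous fun p :
      EuclideanSpace ℝ (Fin m) × EuclideanSpace ℝ (Fin m) => Cc i p.1 p.2)
    -- a C² solution of the closed-loop system
    (q : Fin n → ℝ → EuclideanSpace ℝ (Fin m))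
    (hq : ∀ i, ContDiff ℝ 2 (q i))
    (hMdiff : ∀ i, Differentiable ℝ fun s => M i (q i s))
    -- `Ṁᵢ - 2Cᵢ` is skew-symmetric along the trajectory
    (hskew : ∀ i t v w,
      ⟪(deriv (fun s => M i (q i s)) t - (2 : ℝ) • Cc i (q i t) (deriv (q i) t)) v, w⟫
        = -⟪(deriv (fun s => M i (q i s)) t - (2 : ℝ) • Cc i (q i t) (deriv (q i) t)) w, v⟫)
    -- the Lagrangian dynamics under the control law
    (hdyn : ∀ i t,
      M i (q i t) (deriv (deriv (q i)) t) + Cc i (q i t) (deriv (q i) t) (deriv (q i) t)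
        = -k • deriv (q i) t - (q i t - P i (q i t)) - ∑ j, a i j • (q i t - q j t)) :
    (∀ i, Filter.Tendsto (fun t => Metric.infDist (q i t) (⋂ j, X j)) Filter.atTop (𝓝 0)) ∧
    (∀ i j, Filter.Tendsto (fun t => q i t - q j t) Filter.atTop (𝓝 0)) ∧
    (∀ i, Filter.Tendsto (deriv (q i)) Filter.atTop (𝓝 0)) := by
  set v : Fin n → ℝ → EuclideanSpace ℝ (Fin m) := fun i => deriv (q i) with hv
  set A : Fin n → ℝ → EuclideanSpace ℝ (Fin m) := fun i => deriv (deriv (q i)) with hA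
  set g : Fin n → ℝ → EuclideanSpace ℝ (Fin m) :=
    fun i t => (q i t - P i (q i t)) + ∑ j, a i j • (q i t - q j t) with hg
  have hqv : ∀ i t, HasDerivAt (q i) (v i t) t := fun i t =>
    ((hq i).differentiable (by norm_num) t).hasDerivAt
  have hvA : ∀ i t, HasDerivAt (v i) (A i t) t := fun i t => by
    have h1 : ContDiff ℝ (1 + 1) (q i) := by
      have := hq i
      norm_num
      exact this
    exact (((contDiff_succ_iff_deriv.1 h1).2.2).differentiable (by norm_num) t).hasDerivAt
  have hdyn' : ∀ i t, M i (q i t) (A i t) = -(Cc i (q i t) (v i t) (v i t)) - k • v i t - g i t := by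
    intro i t
    have h := hdyn i t
    rw [← eq_sub_iff_add_eq] at h
    rw [show M i (q i t) (A i t) = _ from h]
    simp only [hg, hv, neg_smul]
    abel
  have hMd : ∀ i t, HasDerivAt (fun s => M i (q i s)) (deriv (fun s => M i (q i s)) t) t :=
    fun i t => (hMdiff i t).hasDerivAt
  have hmdot := fun i t => mdot_apply (fun s => M i (q i s)) (deriv (fun s => M i (q i s)) t)
    (Cc i (q i t) (v i t)) t (hMd i t) (fun s => hMsymm i (q i s)) (hskew i t)
  -- energy
  set V : ℝ → ℝ := fun t => ∑ i, (⟪M i (q i t) (v i t), v i t⟫ / 2 + ‖q i t - P i (q i t)‖ ^ 2 / 2) +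
    ∑ i, ∑ j, a i j * ‖q i t - q j t‖ ^ 2 / 4 with hV
  set K : ℝ → ℝ := fun t => k * ∑ i, ‖v i t‖ ^ 2 with hK
  have hVd : ∀ t, HasDerivAt V (0 - K t) t := by
    intro t
    have h1 : ∀ i ∈ Finset.univ, HasDerivAt (fun t => ⟪M i (q i t) (v i t), v i t⟫ / 2 +
        ‖q i t - P i (q i t)‖ ^ 2 / 2) (-k * ‖v i t‖ ^ 2 -
          ⟪∑ j, a i j • (q i t - q j t), v i t⟫) t := by
      intro i _
      have e1 := ((((hMd i t).clm_apply (hvA i t)).inner ℝ (hvA i t)).div_const 2)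
      have e2 := (proj_fderiv (hXconvex i) (hPmem i) (hPproj i) (q i t)).comp_hasDerivAt t (hqv i t)
      refine (e1.add e2).congr_deriv ?_
      rw [innerSL_apply_apply, inner_add_left, (hmdot i t (v i t)).1, hMsymm,
        real_inner_comm (M i (q i t) (A i t)) (v i t), hdyn' i t, ← real_inner_self_eq_norm_sq]
      simp only [hg, inner_sub_left, inner_neg_left, real_inner_smul_left, inner_add_left]
      ring
    have h2 : ∀ i ∈ Finset.univ, HasDerivAt (fun t => ∑ j, a i j * ‖q i t - q j t‖ ^ 2 / 4)
        (∑ j, a i j * ⟪q i t - q j t, v i t - v j t⟫ / 2) t := by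
      intro i _
      refine HasDerivAt.fun_sum fun j _ => ?_
      refine (((((hqv i t).sub (hqv j t)).norm_sq).const_mul (a i j)).div_const 4).congr_deriv ?_
      simp only [Pi.sub_apply]
      ring
    refine ((HasDerivAt.fun_sum h1).add (HasDerivAt.fun_sum h2)).congr_deriv ?_
    rw [← pair_sum a ha_symm (fun i => q i t) (fun i => v i t), Finset.sum_sub_distrib,
      ← Finset.mul_sum]
    simp only [hK]
    ring
  have hKnn : ∀ t, 0 ≤ K t := fun t => by simp only [hK]; positivity
  have hVanti : Antitone V := antitone_of_hasDerivAt_nonpos hVd fun t => by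
    have := hKnn t
    simp only [Pi.zero_apply]
    linarith
  have hMnn : ∀ i t, 0 ≤ ⟪M i (q i t) (v i t), v i t⟫ := fun i t =>
    le_trans (by positivity) (hMlower i (q i t) (v i t))
  have hann : ∀ t i j, 0 ≤ a i j * ‖q i t - q j t‖ ^ 2 / 4 := fun t i j => by
    have := ha_nonneg i j
    positivity
  have hV1 : ∀ t i, ⟪M i (q i t) (v i t), v i t⟫ / 2 + ‖q i t - P i (q i t)‖ ^ 2 / 2 ≤ V t := by
    intro t i
    have h1 := Finset.single_le_sum (f := fun i => ⟪M i (q i t) (v i t), v i t⟫ / 2 +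
      ‖q i t - P i (q i t)‖ ^ 2 / 2) (fun i _ => by have := hMnn i t; positivity) (Finset.mem_univ i)
    have h2 : 0 ≤ ∑ i, ∑ j, a i j * ‖q i t - q j t‖ ^ 2 / 4 :=
      Finset.sum_nonneg fun i _ => Finset.sum_nonneg fun j _ => hann t i j
    simp only [hV]
    linarith
  have hV2 : ∀ t i j, a i j * ‖q i t - q j t‖ ^ 2 / 4 ≤ V t := by
    intro t i j
    have h1 : 0 ≤ ∑ i, (⟪M i (q i t) (v i t), v i t⟫ / 2 +
      ‖q i t - P i (q i t)‖ ^ 2 / 2) := Finset.sum_nonneg fun i _ => by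
        have := hMnn i t; positivity
    have h2 := Finset.single_le_sum (f := fun i => ∑ j, a i j * ‖q i t - q j t‖ ^ 2 / 4)
      (fun i _ => Finset.sum_nonneg fun j _ => hann t i j) (Finset.mem_univ i)
    have h3 := Finset.single_le_sum (f := fun j => a i j * ‖q i t - q j t‖ ^ 2 / 4)
      (fun j _ => hann t i j) (Finset.mem_univ j)
    simp only [hV]
    linarith
  have hVnn : ∀ t, 0 ≤ V t := fun t => le_trans (by
    have := hMnn ⟨0, hn⟩ t; positivity) (hV1 t ⟨0, hn⟩)
  obtain ⟨Vl, hVlim⟩ : ∃ c, Filter.Tendsto V Filter.atTop (𝓝 c) :=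
    ⟨_, tendsto_atTop_ciInf hVanti ⟨0, by rintro _ ⟨t, rfl⟩; exact hVnn t⟩⟩
  -- bounds
  obtain ⟨B, hB0, hBv⟩ : ∃ B : ℝ, 0 ≤ B ∧ ∀ i t, 0 ≤ t → ‖v i t‖ ≤ B := by
    refine ⟨Real.sqrt (2 * V 0 / μ₁), Real.sqrt_nonneg _, fun i t ht => ?_⟩
    apply Real.le_sqrt_of_sq_le
    rw [le_div_iff₀ hμ₁]
    have h1 := hV1 t i
    have h2 := hMlower i (q i t) (v i t)
    have h3 := hVanti ht
    nlinarith [sq_nonneg ‖q i t - P i (q i t)‖]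
  obtain ⟨D, hD0, hD⟩ : ∃ D : ℝ, 0 ≤ D ∧ ∀ i t, 0 ≤ t → ‖q i t - P i (q i t)‖ ≤ D := by
    refine ⟨Real.sqrt (2 * V 0), Real.sqrt_nonneg _, fun i t ht => ?_⟩
    apply Real.le_sqrt_of_sq_le
    linarith [hV1 t i, hMnn i t, hVanti ht]
  have hpair : ∀ i j, ∃ B : ℝ, ∀ t, 0 ≤ t → ‖q i t - q j t‖ ≤ B := by
    refine conn_ind a hconn _ ?_ ?_ ?_ ?_
    · exact fun i => ⟨0, fun t _ => by simp⟩
    · rintro i j ⟨B, hB⟩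
      exact ⟨B, fun t ht => by rw [norm_sub_rev]; exact hB t ht⟩
    · rintro i j l ⟨B1, h1⟩ ⟨B2, h2⟩
      refine ⟨B1 + B2, fun t ht => ?_⟩
      rw [← sub_add_sub_cancel (q i t) (q j t) (q l t)]
      exact (norm_add_le _ _).trans (add_le_add (h1 t ht) (h2 t ht))
    · intro i j hij
      refine ⟨Real.sqrt (4 * V 0 / a i j), fun t ht => ?_⟩
      apply Real.le_sqrt_of_sq_le
      rw [le_div_iff₀ hij]
      linarith [hV2 t i j, hVanti ht]
  choose Q hQ using hpair
  have hQ0 : ∀ i j, 0 ≤ Q i j := fun i j => (norm_nonneg _).trans (hQ i j 0 le_rfl)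
  obtain ⟨x0, hx0⟩ := hX0ne
  have hx0' : ∀ i, x0 ∈ X i := Set.mem_iInter.1 hx0
  have hqb : ∀ i, ∃ R : ℝ, 0 ≤ R ∧ ∀ t, 0 ≤ t → ‖q i t - x0‖ ≤ R := by
    intro i
    obtain ⟨R, hR0, hR⟩ := coercive hXconvex hPmem hPproj x0 hx0' hX0bdd (∑ j, Q i j + D)
    refine ⟨R, hR0, fun t ht => hR _ fun j => ?_⟩
    refine (hPproj j (q i t) (P j (q j t)) (hPmem _ _)).trans ?_
    rw [← sub_add_sub_cancel (q i t) (q j t) (P j (q j t))]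
    refine (norm_add_le _ _).trans (add_le_add ((hQ i j t ht).trans ?_) (hD j t ht))
    exact Finset.single_le_sum (f := fun j => Q i j) (fun j _ => hQ0 i j) (Finset.mem_univ j)
  choose R hR0 hR using hqb
  have hgb : ∀ i, ∃ G : ℝ, 0 ≤ G ∧ ∀ t, 0 ≤ t → ‖g i t‖ ≤ G := by
    intro i
    have key : ∀ t, 0 ≤ t → ‖g i t‖ ≤ D + ∑ j, a i j * Q i j := by
      intro t ht
      refine (norm_add_le _ _).trans (add_le_add (hD i t ht) ?_)
      refine (norm_sum_le _ _).trans (Finset.sum_le_sum fun j _ => ?_)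
      rw [norm_smul, Real.norm_of_nonneg (ha_nonneg i j)]
      exact mul_le_mul_of_nonneg_left (hQ i j t ht) (ha_nonneg i j)
    exact ⟨_, (norm_nonneg _).trans (key 0 le_rfl), key⟩
  have hCv : ∀ i t, ‖Cc i (q i t) (v i t) (v i t)‖ ≤ kC * ‖v i t‖ * ‖v i t‖ := fun i t =>
    (ContinuousLinearMap.le_opNorm _ _).trans
      (mul_le_mul_of_nonneg_right (hCbound _ _ _) (norm_nonneg _))
  have hAb : ∀ i, ∃ G : ℝ, 0 ≤ G ∧ ∀ t, 0 ≤ t → ‖A i t‖ ≤ G := by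
    intro i
    obtain ⟨G, hG0, hG⟩ := hgb i
    refine ⟨(kC * B * B + k * B + G) / μ₁, by positivity, fun t ht => ?_⟩
    rw [le_div_iff₀ hμ₁]
    have h1 : ‖M i (q i t) (A i t)‖ ≤ kC * B * B + k * B + G := by
      rw [hdyn' i t]
      have hb := hBv i t ht
      refine (norm_sub_le _ _).trans (add_le_add ((norm_sub_le _ _).trans (add_le_add ?_ ?_)) (hG t ht))
      · rw [norm_neg]
        refine (hCv i t).trans ?_
        gcongr
      · rw [norm_smul, Real.norm_of_nonneg hk.le]
        gcongr
    have h2 := hMlower i (q i t) (A i t)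
    have h3 := real_inner_le_norm (M i (q i t) (A i t)) (A i t)
    by_contra hc
    push Not at hc
    have h4 : 0 < ‖A i t‖ := by
      by_contra h0
      have : ‖A i t‖ = 0 := le_antisymm (not_lt.1 h0) (norm_nonneg _)
      rw [this] at hc
      have : 0 ≤ kC * B * B + k * B + G := by positivity
      linarith
    nlinarith
  choose G hG0 hG using hAb
  -- velocities tend to zero
  have hKd : ∀ t, HasDerivAt K (k * ∑ i, 2 * ⟪v i t, A i t⟫) t := fun t =>
    (HasDerivAt.fun_sum fun i _ => (hvA i t).norm_sq).const_mul k
  have hK0 : Filter.Tendsto K Filter.atTop (𝓝 0) := by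
    refine barb V (fun _ => 0) K Vl hVlim hVd tendsto_const_nhds (k * ∑ i, 2 * (B * G i))
      (mul_nonneg hk.le (Finset.sum_nonneg fun i _ =>
        mul_nonneg (by norm_num) (mul_nonneg hB0 (hG0 i)))) ?_
    intro s t hs hst
    refine norm_image_sub_le_of_norm_deriv_le_segment' (f' := fun t => k * ∑ i, 2 * ⟪v i t, A i t⟫)
      (fun x _ => (hKd x).hasDerivWithinAt) ?_ t ⟨hst, le_rfl⟩
    intro x hx
    have hx0 : 0 ≤ x := hs.trans hx.1
    rw [norm_mul, Real.norm_of_nonneg hk.le]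
    refine mul_le_mul_of_nonneg_left ?_ hk.le
    refine (norm_sum_le _ _).trans (Finset.sum_le_sum fun i _ => ?_)
    rw [norm_mul, Real.norm_of_nonneg (by norm_num : (0:ℝ) ≤ 2)]
    refine mul_le_mul_of_nonneg_left ?_ (by norm_num)
    exact (norm_inner_le_norm _ _).trans
      (mul_le_mul (hBv i x hx0) (hG i x hx0) (norm_nonneg _) hB0)
  have hsq : ∀ f : ℝ → EuclideanSpace ℝ (Fin m),
      Filter.Tendsto (fun t => ‖f t‖ ^ 2) Filter.atTop (𝓝 0) →
      Filter.Tendsto f Filter.atTop (𝓝 0) := by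
    intro f hf
    rw [tendsto_zero_iff_norm_tendsto_zero]
    have := hf.sqrt
    simpa [Real.sqrt_sq] using this
  have hv0 : ∀ i, Filter.Tendsto (v i) Filter.atTop (𝓝 0) := by
    intro i
    apply hsq
    have h1 : Filter.Tendsto (fun t => K t / k) Filter.atTop (𝓝 0) := by
      simpa using hK0.div_const k
    refine squeeze_zero (fun t => by positivity) (fun t => ?_) h1
    rw [le_div_iff₀ hk, mul_comm]
    exact mul_le_mul_of_nonneg_left (Finset.single_le_sum (f := fun i => ‖v i t‖ ^ 2)
      (fun i _ => by positivity) (Finset.mem_univ i)) hk.le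
  have hvn : ∀ i, Filter.Tendsto (fun t => ‖v i t‖) Filter.atTop (𝓝 0) := fun i => by
    simpa using (hv0 i).norm
  -- forces tend to zero
  have hqL : ∀ i s t, 0 ≤ s → s ≤ t → ‖q i t - q i s‖ ≤ B * (t - s) := by
    intro i s t hs hst
    exact norm_image_sub_le_of_norm_deriv_le_segment'
      (fun x _ => (hqv i x).hasDerivWithinAt) (fun x hx => hBv i x (hs.trans hx.1)) t ⟨hst, le_rfl⟩
  have hg0 : ∀ i, Filter.Tendsto (g i) Filter.atTop (𝓝 0) := by
    intro i
    obtain ⟨KM, hKM⟩ := (isCompact_closedBall x0 (R i)).exists_bound_of_continuousOn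
      (hMcont i).continuousOn
    refine barb (fun t => M i (q i t) (v i t))
      (fun t => (deriv (fun s => M i (q i s)) t) (v i t) - Cc i (q i t) (v i t) (v i t) - k • v i t)
      (g i) 0 ?_ ?_ ?_ (2 * B + ∑ j, a i j * (2 * B)) (add_nonneg (by positivity)
        (Finset.sum_nonneg fun j _ => mul_nonneg (ha_nonneg i j) (by positivity))) ?_
    · have h1 : Filter.Tendsto (fun t => KM * ‖v i t‖) Filter.atTop (𝓝 0) := by
        simpa using (hvn i).const_mul KM
      refine squeeze_zero_norm' ?_ h1
      filter_upwards [Filter.eventually_ge_atTop 0] with t ht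
      refine (ContinuousLinearMap.le_opNorm _ _).trans
        (mul_le_mul_of_nonneg_right (hKM _ ?_) (norm_nonneg _))
      rw [Metric.mem_closedBall, dist_eq_norm]
      exact hR i t ht
    · intro t
      refine ((hMd i t).clm_apply (hvA i t)).congr_deriv ?_
      rw [hdyn' i t]
      abel
    · have h1 : Filter.Tendsto (fun t => 3 * kC * ‖v i t‖ * ‖v i t‖ + k * ‖v i t‖)
          Filter.atTop (𝓝 0) := by
        simpa using (((hvn i).const_mul (3 * kC)).mul (hvn i)).add ((hvn i).const_mul k)
      refine squeeze_zero_norm (fun t => ?_) h1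
      have h2 := (hmdot i t (v i t)).2
      have h3 := hCv i t
      have h4 : 2 * ‖Cc i (q i t) (v i t)‖ * ‖v i t‖ ≤ 2 * (kC * ‖v i t‖) * ‖v i t‖ := by
        have := hCbound i (q i t) (v i t)
        gcongr
      have h5 : ‖k • v i t‖ = k * ‖v i t‖ := by rw [norm_smul, Real.norm_of_nonneg hk.le]
      refine (norm_sub_le _ _).trans ?_
      have h6 := norm_sub_le ((deriv (fun s => M i (q i s)) t) (v i t))
        (Cc i (q i t) (v i t) (v i t))
      linarith
    · intro s t hs hst
      have e1 : g i t - g i s = ((q i t - P i (q i t)) - (q i s - P i (q i s))) +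
          ∑ j, a i j • ((q i t - q i s) - (q j t - q j s)) := by
        have : ∑ j, a i j • ((q i t - q i s) - (q j t - q j s)) =
            ∑ j, a i j • (q i t - q j t) - ∑ j, a i j • (q i s - q j s) := by
          rw [← Finset.sum_sub_distrib]
          refine Finset.sum_congr rfl fun j _ => ?_
          rw [← smul_sub]
          congr 1
          abel
        rw [this]
        simp only [hg]
        abel
      rw [e1, add_mul, Finset.sum_mul]
      refine (norm_add_le _ _).trans (add_le_add ?_ ?_)
      · refine (res_lip (hXconvex i) (hPmem i) (hPproj i) _ _).trans ?_
        linarith [hqL i s t hs hst]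
      · refine (norm_sum_le _ _).trans (Finset.sum_le_sum fun j _ => ?_)
        rw [norm_smul, Real.norm_of_nonneg (ha_nonneg i j), mul_assoc]
        refine mul_le_mul_of_nonneg_left ?_ (ha_nonneg i j)
        linarith [norm_sub_le (q i t - q i s) (q j t - q j s), hqL i s t hs hst, hqL j s t hs hst]
  -- conclusion
  set S : ℝ → ℝ := fun t => ∑ i, ⟪g i t, q i t - x0⟫ with hS
  have hS0 : Filter.Tendsto S Filter.atTop (𝓝 0) := by
    have h1 : Filter.Tendsto (fun t => ∑ i, ‖g i t‖ * R i) Filter.atTop (𝓝 0) := by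
      have := tendsto_finsetSum Finset.univ fun i _ => ((hg0 i).norm).mul_const (R i)
      simpa using this
    refine squeeze_zero_norm' ?_ h1
    filter_upwards [Filter.eventually_ge_atTop 0] with t ht
    refine (norm_sum_le _ _).trans (Finset.sum_le_sum fun i _ => ?_)
    exact (norm_inner_le_norm _ _).trans (mul_le_mul_of_nonneg_left (hR i t ht) (norm_nonneg _))
  have hSge : ∀ t, ∑ i, ‖q i t - P i (q i t)‖ ^ 2 + ∑ i, ∑ j, a i j * ‖q i t - q j t‖ ^ 2 / 2 ≤ S t := by
    intro t
    have h1 := pair_sum a ha_symm (fun i => q i t) (fun i => q i t - x0)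
    simp only [sub_sub_sub_cancel_right, real_inner_self_eq_norm_sq] at h1
    simp only [hS, hg, inner_add_left, Finset.sum_add_distrib]
    rw [h1]
    refine add_le_add_left (Finset.sum_le_sum fun i _ => ?_) _
    have h2 := proj_inner (hXconvex i) (hPmem i) (hPproj i) (q i t) x0 (hx0' i)
    have h3 : q i t - x0 = (q i t - P i (q i t)) - (x0 - P i (q i t)) := by abel
    rw [h3, inner_sub_right, real_inner_self_eq_norm_sq]
    linarith
  have hd0 : ∀ i, Filter.Tendsto (fun t => q i t - P i (q i t)) Filter.atTop (𝓝 0) := by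
    intro i
    apply hsq
    refine squeeze_zero (fun t => by positivity) (fun t => ?_) hS0
    have h1 := Finset.single_le_sum (f := fun i => ‖q i t - P i (q i t)‖ ^ 2)
      (fun i _ => by positivity) (Finset.mem_univ i)
    have h2 : 0 ≤ ∑ i, ∑ j, a i j * ‖q i t - q j t‖ ^ 2 / 2 :=
      Finset.sum_nonneg fun i _ => Finset.sum_nonneg fun j _ => by linarith [hann t i j]
    linarith [hSge t]
  have hp0 : ∀ i j, Filter.Tendsto (fun t => q i t - q j t) Filter.atTop (𝓝 0) := by
    refine conn_ind a hconn _ ?_ ?_ ?_ ?_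
    · intro i
      simp
    · intro i j h
      simpa using h.neg
    · intro i j l h1 h2
      simpa using h1.add h2
    · intro i j hij
      apply hsq
      have h1 : Filter.Tendsto (fun t => S t * 2 / a i j) Filter.atTop (𝓝 0) := by
        simpa using (hS0.mul_const 2).div_const (a i j)
      refine squeeze_zero (fun t => by positivity) (fun t => ?_) h1
      rw [le_div_iff₀ hij]
      have h1 : 0 ≤ ∑ i, ‖q i t - P i (q i t)‖ ^ 2 := by positivity
      have h2 := Finset.single_le_sum (f := fun i => ∑ j, a i j * ‖q i t - q j t‖ ^ 2 / 2)
        (fun i _ => Finset.sum_nonneg fun j _ => by linarith [hann t i j]) (Finset.mem_univ i)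
      have h3 := Finset.single_le_sum (f := fun j => a i j * ‖q i t - q j t‖ ^ 2 / 2)
        (fun j _ => by linarith [hann t i j]) (Finset.mem_univ j)
      linarith [hSge t]
  refine ⟨fun i => ?_, hp0, hv0⟩
  refine infdist_tendsto hXconvex hPmem hPproj (q i) x0 (R i) (hR i) fun j => ?_
  have h1 : Filter.Tendsto (fun t => ‖q i t - q j t‖ + ‖q j t - P j (q j t)‖)
      Filter.atTop (𝓝 0) := by
    simpa using (hp0 i j).norm.add (hd0 j).norm
  refine squeeze_zero_norm (fun t => ?_) h1
  refine (hPproj j (q i t) (P j (q j t)) (hPmem _ _)).trans ?_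
  rw [← sub_add_sub_cancel (q i t) (q j t) (P j (q j t))]
  exact norm_add_le _ _
end

section
/- Let 0 < r < R and let W be the collision-avoidance potential with parameters r, R. Let γ : [t₀, ∞) → ℝ^m be continuous with ‖γ(t₀)‖ > r, and suppose there is a constant B ≥ 0 such that W(γ(t)) ≤ B for all t ≥ t₀ at which ‖γ(t)‖ > r. Then ‖γ(t)‖ > r for all t ≥ t₀. -/
/-- The collision-avoidance potential with parameters `r < R`. -/
noncomputable def collisionPotential (m : ℕ) (r R : ℝ)
    (z : EuclideanSpace ℝ (Fin m)) : ℝ :=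
  if R ≤ ‖z‖ then 0 else ((‖z‖ ^ 2 - R ^ 2) / (‖z‖ ^ 2 - r ^ 2)) ^ 2

/-- If `γ` is continuous on `[t₀, ∞)` with `‖γ(t₀)‖ > r` and the
collision-avoidance potential along `γ` is bounded by a constant `B ≥ 0` whenever
`‖γ(t)‖ > r`, then `‖γ(t)‖ > r` for all `t ≥ t₀`. -/
theorem statement14
    (m : ℕ) (r R : ℝ) (hr : 0 < r) (hrR : r < R) (t₀ : ℝ)
    (γ : ℝ → EuclideanSpace ℝ (Fin m))
    (hγ : ContinuousOn γ (Set.Ici t₀))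
    (hinit : r < ‖γ t₀‖)
    (B : ℝ) (hB : 0 ≤ B)
    (hbound : ∀ t, t₀ ≤ t → r < ‖γ t‖ → collisionPotential m r R (γ t) ≤ B) :
    ∀ t, t₀ ≤ t → r < ‖γ t‖ := by
  intro t ht
  by_contra hcon
  push Not at hcon
  obtain ⟨δ, hδ, h1, h2⟩ : ∃ δ : ℝ, 0 < δ ∧ δ * (B + 2) ≤ R ^ 2 - r ^ 2 ∧ δ ≤ ‖γ t₀‖ ^ 2 - r ^ 2 := by
    have hB2 : 0 < B + 2 := by linarith
    have hA : 0 < R ^ 2 - r ^ 2 := by nlinarith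
    have hC : 0 < ‖γ t₀‖ ^ 2 - r ^ 2 := by nlinarith
    refine ⟨min ((R ^ 2 - r ^ 2) / (B + 2)) (‖γ t₀‖ ^ 2 - r ^ 2),
      lt_min (div_pos hA hB2) hC, ?_, min_le_right _ _⟩
    rw [← le_div_iff₀ hB2]
    exact min_le_left _ _
  have hs : r < √(r ^ 2 + δ) := Real.lt_sqrt_of_sq_lt (by linarith)
  have hsq : √(r ^ 2 + δ) ^ 2 = r ^ 2 + δ := Real.sq_sqrt (by positivity)
  have hs0 : √(r ^ 2 + δ) ≤ ‖γ t₀‖ := Real.sqrt_le_iff.mpr ⟨norm_nonneg _, by linarith⟩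
  have hcont : ContinuousOn (fun u => ‖γ u‖) (Set.Icc t₀ t) :=
    (hγ.mono Set.Icc_subset_Ici_self).norm
  obtain ⟨u, hu, hue⟩ := intermediate_value_Icc' ht hcont ⟨hcon.trans hs.le, hs0⟩
  have hue' : ‖γ u‖ = √(r ^ 2 + δ) := hue
  have hsR : √(r ^ 2 + δ) < R :=
    (Real.sqrt_lt' (hr.trans hrR)).mpr (by nlinarith [mul_nonneg hδ.le hB])
  have hb := hbound u hu.1 (hue'.symm ▸ hs)
  rw [collisionPotential, hue', if_neg (not_le.mpr hsR), hsq] at hb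
  have hq : B + 1 ≤ (R ^ 2 - (r ^ 2 + δ)) / δ := by
    rw [le_div_iff₀ hδ]; linarith
  have he : ((r ^ 2 + δ - R ^ 2) / (r ^ 2 + δ - r ^ 2)) ^ 2
      = ((R ^ 2 - (r ^ 2 + δ)) / δ) ^ 2 := by
    rw [add_sub_cancel_left, div_pow, div_pow]; ring
  rw [he] at hb
  nlinarith
end
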